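/- arXiv:2310.10399 — 3 statements merged into one kernel-verified Lean document; each statement's English description precedes it below -/
import Mathlib

section
/- Let (Ω, μ) be a probability space, K ≥ 1, and let Y, Ŷ : Ω → Fin K, A : Ω → Bool, and P̂ : Ω → (Fin K → ℝ) be measurable. Assume (i) group-wise calibration: for every k ∈ Fin K, the conditional expectation of 1{Y = k} with respect to the σ-algebra generated by (P̂, A) equals P̂_k μ-almost surely; and (ii) for every k ∈ Fin K, the conditional expectation of 1{Ŷ = k} with respect to the σ-algebra generated by (P̂, A) equals P̂_k μ-almost surely. Then the model is perfectly fair: for every a ∈ Bool with μ({A = a}) > 0 and every k ∈ Fin K, μ[{Ŷ = k} | {A = a}] = μ[{Y = k} | {A = a}]. -/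
open MeasureTheory ProbabilityTheory

/-- Two events with the same conditional probability given `m` have the same probability jointly
with every `m`-measurable event. -/
theorem measure_inter_eq_of_condExp_indicator_ae_eq {Ω : Type*} {m m₀ : MeasurableSpace Ω}
    {μ : Measure Ω} [IsFiniteMeasure μ] (hm : m ≤ m₀) {s t u : Set Ω}
    (hs : MeasurableSet s) (ht : MeasurableSet t) (hu : MeasurableSet[m] u)
    (h : μ[s.indicator (fun _ => (1 : ℝ)) | m] =ᵐ[μ] μ[t.indicator (fun _ => (1 : ℝ)) | m]) :
    μ (u ∩ s) = μ (u ∩ t) := by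
  have key : ∀ {v : Set Ω}, MeasurableSet v →
      ∫ ω in u, (μ[v.indicator (fun _ => (1 : ℝ)) | m]) ω ∂μ = μ.real (u ∩ v) := by
    intro v hv
    rw [setIntegral_condExp hm ((integrable_const 1).indicator hv) hu, setIntegral_indicator hv]
    simp
  rw [← measureReal_eq_measureReal_iff, ← key hs, ← key ht]
  exact integral_congr_ae (ae_restrict_of_ae h)

theorem groupwise_calibrated_is_perfectly_fair
    {Ω : Type*} [MeasurableSpace Ω] (μ : Measure Ω) [IsProbabilityMeasure μ]
    (K : ℕ) (hK : 1 ≤ K)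
    (Y Yhat : Ω → Fin K) (A : Ω → Bool) (P : Ω → (Fin K → ℝ))
    (hY : Measurable Y) (hYhat : Measurable Yhat) (hA : Measurable A) (hP : Measurable P)
    (hgc : ∀ k : Fin K,
      μ[(fun ω => if Y ω = k then (1 : ℝ) else 0) |
          MeasurableSpace.comap (fun ω => (P ω, A ω)) inferInstance]
        =ᵐ[μ] fun ω => P ω k)
    (hpred : ∀ k : Fin K,
      μ[(fun ω => if Yhat ω = k then (1 : ℝ) else 0) |
          MeasurableSpace.comap (fun ω => (P ω, A ω)) inferInstance]
        =ᵐ[μ] fun ω => P ω k) :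
    ∀ a : Bool, 0 < μ {ω | A ω = a} → ∀ k : Fin K,
      (μ[|{ω | A ω = a}]) {ω | Yhat ω = k} = (μ[|{ω | A ω = a}]) {ω | Y ω = k} := by
  intro a _ k
  have hAmeas : MeasurableSet {ω | A ω = a} := hA (measurableSet_singleton a)
  rw [cond_apply hAmeas, cond_apply hAmeas]
  congr 1
  refine measure_inter_eq_of_condExp_indicator_ae_eq (hP.prodMk hA).comap_le
    (hYhat (measurableSet_singleton k)) (hY (measurableSet_singleton k))
    ⟨Prod.snd ⁻¹' {a}, measurable_snd (measurableSet_singleton a), rfl⟩ ?_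
  have hind : ∀ Z : Ω → Fin K, {ω | Z ω = k}.indicator (fun _ => (1 : ℝ)) =
      fun ω => if Z ω = k then (1 : ℝ) else 0 := by
    intro Z
    funext ω
    simp only [Set.indicator_apply, Set.mem_ofPred_eq]
  rw [hind, hind]
  exact (hpred k).trans (hgc k).symm
end

section
/- Let (Ω, μ) be a probability space, K ≥ 1, and let Y : Ω → Fin K and P̂ : Ω → (Fin K → ℝ) be measurable. Define the top-prediction Ŷ* : Ω → Fin K by Ŷ*(ω) = the (measurably chosen, e.g., least-index) class k maximizing P̂(ω)_k, and the confidence M : Ω → ℝ by M(ω) = max over k of P̂(ω)_k. If the model is perfectly (strongly) calibrated, i.e., for every k ∈ Fin K the conditional expectation of 1{Y = k} with respect to the σ-algebra generated by P̂ equals P̂_k μ-almost surely, then the model is weakly calibrated: the conditional expectation of 1{Y = Ŷ*} with respect to the σ-algebra generated by M equals M μ-almost surely. -/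
open MeasureTheory

/-- If `q k` is the conditional probability of `Y = k` given `m`, then for every `m`-measurable
choice `Z` of a class, `q (Z ω)` is the conditional probability of `Y = Z` given `m`. -/
theorem condExp_ite_eq_of_measurable {Ω ι : Type*} {m m₀ : MeasurableSpace Ω} {μ : Measure Ω}
    [IsFiniteMeasure μ] [Fintype ι] [DecidableEq ι] [MeasurableSpace ι]
    [MeasurableSingletonClass ι] (hm : m ≤ m₀) {Y Z : Ω → ι} {q : ι → Ω → ℝ}
    (hY : Measurable[m₀] Y) (hZ : Measurable[m] Z)
    (hq : ∀ k, μ[(fun ω => if Y ω = k then (1 : ℝ) else 0) | m] =ᵐ[μ] q k) :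
    μ[(fun ω => if Y ω = Z ω then (1 : ℝ) else 0) | m] =ᵐ[μ] fun ω => q (Z ω) ω := by
  have hZk : ∀ k, MeasurableSet[m] (Z ⁻¹' {k}) := fun k => hZ (measurableSet_singleton k)
  have hYint : ∀ k, Integrable (fun ω => if Y ω = k then (1 : ℝ) else 0) μ := fun k =>
    Integrable.of_bound (Measurable.ite (hY (measurableSet_singleton k)) measurable_const
      measurable_const).aestronglyMeasurable 1 (.of_forall fun ω => by split_ifs <;> simp)
  have hsplit : ∀ g : ι → Ω → ℝ,
      (fun ω => g (Z ω) ω) = ∑ k, (Z ⁻¹' {k}).indicator (g k) := by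
    intro g
    ext ω
    rw [Finset.sum_apply, Finset.sum_eq_single (Z ω)]
    · simp
    · intro k _ hk
      exact Set.indicator_of_notMem (fun h => hk h.symm) _
    · simp
  rw [hsplit q, hsplit fun k ω => if Y ω = k then (1 : ℝ) else 0]
  refine (condExp_finsetSum (fun k _ => (hYint k).indicator (hm _ (hZk k))) m).trans ?_
  refine eventuallyEq_sum fun k _ => ?_
  exact (condExp_indicator (hYint k) (hZk k)).trans ((hq k).indicator)

theorem measurable_sup'_apply {Ω ι : Type*} {m : MeasurableSpace Ω} {s : Finset ι}
    (hs : s.Nonempty) {P : Ω → ι → ℝ} (hP : Measurable P) :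
    Measurable fun ω => s.sup' hs fun k => P ω k := by
  convert! Finset.measurable_sup' hs (f := fun k ω => P ω k) fun k _ =>
    measurable_pi_iff.mp hP k using 1
  ext ω
  simp

/-- The least index attaining a maximum is a measurable function of the family. -/
theorem measurable_of_least_index {Ω ι : Type*} {m : MeasurableSpace Ω} [Countable ι]
    [LinearOrder ι] [MeasurableSpace ι] {P : Ω → ι → ℝ} {M : Ω → ℝ} {Z : Ω → ι}
    (hP : Measurable P) (hM : Measurable M) (hZ : ∀ ω, P ω (Z ω) = M ω)
    (hleast : ∀ ω k, P ω k = M ω → Z ω ≤ k) : Measurable Z := by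
  refine measurable_to_countable' fun k => ?_
  have hset : Z ⁻¹' {k} = {ω | P ω k = M ω} ∩ ⋂ j, ⋂ _ : j < k, {ω | P ω j = M ω}ᶜ := by
    ext ω
    simp only [Set.mem_preimage, Set.mem_singleton_iff, Set.mem_inter_iff, Set.mem_ofPred_eq,
      Set.mem_iInter, Set.mem_compl_iff]
    constructor
    · rintro rfl
      exact ⟨hZ ω, fun j hj h => (hleast ω j h).not_gt hj⟩
    · rintro ⟨hk, hlt⟩
      exact (hleast ω k hk).eq_of_not_lt fun h => hlt _ h (hZ ω)
  have hmeas : ∀ j, MeasurableSet {ω | P ω j = M ω} := fun j =>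
    measurableSet_eq_fun (measurable_pi_iff.mp hP j) hM
  rw [hset]
  exact (hmeas k).inter (.iInter fun j => .iInter fun _ => (hmeas j).compl)

theorem strongly_calibrated_is_weakly_calibrated
    {Ω : Type*} [MeasurableSpace Ω] (μ : Measure Ω) [IsProbabilityMeasure μ]
    (K : ℕ) (hK : 1 ≤ K)
    (Y : Ω → Fin K) (P : Ω → (Fin K → ℝ))
    (hY : Measurable Y) (hP : Measurable P)
    (Ystar : Ω → Fin K) (M : Ω → ℝ)
    (hYstarMeas : Measurable Ystar) (hMMeas : Measurable M)
    -- M is the confidence: the maximum predicted probability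
    (hM : ∀ ω, M ω = Finset.univ.sup' (Finset.univ_nonempty_iff.mpr ⟨(⟨0, hK⟩ : Fin K)⟩)
      (fun k : Fin K => P ω k))
    -- Ystar is the least-index class attaining the maximum
    (hYstarMax : ∀ ω, P ω (Ystar ω) = M ω)
    (hYstarLeast : ∀ ω, ∀ k : Fin K, P ω k = M ω → Ystar ω ≤ k)
    -- strong (perfect) calibration
    (hcal : ∀ k : Fin K,
      μ[(fun ω => if Y ω = k then (1 : ℝ) else 0) |
          MeasurableSpace.comap P inferInstance]
        =ᵐ[μ] fun ω => P ω k) :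
    -- weak calibration
    μ[(fun ω => if Y ω = Ystar ω then (1 : ℝ) else 0) |
        MeasurableSpace.comap M inferInstance]
      =ᵐ[μ] M := by
  have hPm : Measurable[MeasurableSpace.comap P inferInstance] P := comap_measurable P
  have hMm : Measurable[MeasurableSpace.comap P inferInstance] M := by
    rw [funext hM]
    exact measurable_sup'_apply _ hPm
  have hZm : Measurable[MeasurableSpace.comap P inferInstance] Ystar :=
    measurable_of_least_index hPm hMm hYstarMax hYstarLeast
  have hstar : μ[(fun ω => if Y ω = Ystar ω then (1 : ℝ) else 0) |
      MeasurableSpace.comap P inferInstance] =ᵐ[μ] M := by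
    simpa only [hYstarMax] using condExp_ite_eq_of_measurable hP.comap_le hY hZm hcal
  have hMint : Integrable M μ := integrable_condExp.congr hstar
  have htower := condExp_condExp_of_le (μ := μ)
    (f := fun ω => if Y ω = Ystar ω then (1 : ℝ) else 0) hMm.comap_le hP.comap_le
  refine htower.symm.trans ((condExp_congr_ae hstar).trans ?_)
  rw [condExp_of_stronglyMeasurable hMMeas.comap_le (comap_measurable M).stronglyMeasurable hMint]
end

section
/- Let (Ω, μ) be a probability space, K ≥ 1, and let Y, Ŷ : Ω → Fin K, A : Ω → Bool, and P̂ : Ω → (Fin K → ℝ) be measurable, with μ({A = a}) > 0 for both a ∈ Bool. Assume group-wise calibration of the label and of the prediction: for every k ∈ Fin K, both E[1{Y = k} | σ(P̂, A)] = P̂_k and E[1{Ŷ = k} | σ(P̂, A)] = P̂_k hold μ-almost surely. Then the model is simultaneously perfectly calibrated and perfectly fair: (i) for every k ∈ Fin K, E[1{Y = k} | σ(P̂)] = P̂_k μ-almost surely, and (ii) for every a ∈ Bool and every k ∈ Fin K, μ[{Ŷ = k} | {A = a}] = μ[{Y = k} | {A = a}]. -/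
open MeasureTheory ProbabilityTheory

/-- A version of `μ[f | m₂]` that is measurable with respect to a coarser `m₁` is also a version of
`μ[f | m₁]`. -/
theorem condExp_ae_eq_of_le_of_stronglyMeasurable {Ω : Type*} {m₁ m₂ m₀ : MeasurableSpace Ω}
    {μ : Measure Ω} [IsFiniteMeasure μ] {f g : Ω → ℝ} (h₁₂ : m₁ ≤ m₂) (h₂ : m₂ ≤ m₀)
    (hg : StronglyMeasurable[m₁] g) (hfg : μ[f | m₂] =ᵐ[μ] g) : μ[f | m₁] =ᵐ[μ] g := by
  have hgi : Integrable g μ := integrable_condExp.congr hfg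
  calc μ[f | m₁] =ᵐ[μ] μ[μ[f | m₂] | m₁] := (condExp_condExp_of_le h₁₂ h₂).symm
    _ =ᵐ[μ] μ[g | m₁] := condExp_congr_ae hfg
    _ =ᵐ[μ] g := by rw [condExp_of_stronglyMeasurable (h₁₂.trans h₂) hg hgi]

/-- Events with the same conditional probability given `m` have the same probability conditionally
on any event of `m`. -/
theorem cond_apply_eq_of_condExp_indicator_ae_eq {Ω : Type*} {m m₀ : MeasurableSpace Ω}
    {μ : Measure Ω} [IsFiniteMeasure μ] {s t u : Set Ω} (hm : m ≤ m₀)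
    (hs : MeasurableSet s) (ht : MeasurableSet t) (hu : MeasurableSet[m] u)
    (h : μ[s.indicator (fun _ => (1 : ℝ)) | m] =ᵐ[μ] μ[t.indicator (fun _ => (1 : ℝ)) | m]) :
    (μ[|u]) s = (μ[|u]) t := by
  have key : ∀ {v : Set Ω}, MeasurableSet v →
      ∫ x in u, (μ[v.indicator (fun _ => (1 : ℝ)) | m]) x ∂μ = μ.real (u ∩ v) := by
    intro v hv
    rw [setIntegral_condExp hm ((integrable_const _).indicator hv) hu,
      setIntegral_indicator hv, setIntegral_const, smul_eq_mul, mul_one]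
  have hreal : μ.real (u ∩ s) = μ.real (u ∩ t) := by
    rw [← key hs, ← key ht]
    exact integral_congr_ae (ae_restrict_of_ae h)
  rw [cond_apply (hm u hu), cond_apply (hm u hu), (measureReal_eq_measureReal_iff).1 hreal]

theorem groupwise_calibrated_is_calibrated_and_fair
    {Ω : Type*} [MeasurableSpace Ω] (μ : Measure Ω) [IsProbabilityMeasure μ]
    (K : ℕ) (hK : 1 ≤ K)
    (Y Yhat : Ω → Fin K) (A : Ω → Bool) (P : Ω → (Fin K → ℝ))
    (hY : Measurable Y) (hYhat : Measurable Yhat) (hA : Measurable A) (hP : Measurable P)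
    (hApos : ∀ a : Bool, 0 < μ {ω | A ω = a})
    (hgc : ∀ k : Fin K,
      μ[(fun ω => if Y ω = k then (1 : ℝ) else 0) |
          MeasurableSpace.comap (fun ω => (P ω, A ω)) inferInstance]
        =ᵐ[μ] fun ω => P ω k)
    (hpred : ∀ k : Fin K,
      μ[(fun ω => if Yhat ω = k then (1 : ℝ) else 0) |
          MeasurableSpace.comap (fun ω => (P ω, A ω)) inferInstance]
        =ᵐ[μ] fun ω => P ω k) :
    (∀ k : Fin K,
      μ[(fun ω => if Y ω = k then (1 : ℝ) else 0) |
          MeasurableSpace.comap P inferInstance]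
        =ᵐ[μ] fun ω => P ω k) ∧
    (∀ a : Bool, ∀ k : Fin K,
      (μ[|{ω | A ω = a}]) {ω | Yhat ω = k} = (μ[|{ω | A ω = a}]) {ω | Y ω = k}) := by
  have hm : MeasurableSpace.comap (fun ω => (P ω, A ω)) inferInstance ≤ ‹MeasurableSpace Ω› :=
    (hP.prodMk hA).comap_le
  have hPA : Measurable[MeasurableSpace.comap (fun ω => (P ω, A ω)) inferInstance]
      fun ω => (P ω, A ω) := comap_measurable _
  have ite_eq (Z : Ω → Fin K) (k : Fin K) : (fun ω => if Z ω = k then (1 : ℝ) else 0) =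
      {ω | Z ω = k}.indicator fun _ => (1 : ℝ) := by
    ext ω
    simp [Set.indicator_apply]
  refine ⟨fun k => ?_, fun a k => ?_⟩
  · exact condExp_ae_eq_of_le_of_stronglyMeasurable (measurable_fst.comp hPA).comap_le hm
      ((measurable_pi_apply k).comp (comap_measurable P)).stronglyMeasurable (hgc k)
  · have h := (hpred k).trans (hgc k).symm
    rw [ite_eq, ite_eq] at h
    exact cond_apply_eq_of_condExp_indicator_ae_eq hm (hYhat (measurableSet_singleton k))
      (hY (measurableSet_singleton k))
      ((measurable_snd.comp hPA) (measurableSet_singleton a)) h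
end
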